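/- arXiv:1903.02177 — 2 statements merged into one kernel-verified Lean document; each statement's English description precedes it below -/
import Mathlib

section
/- Let U be a set and let E ⊆ U×U be a reflexive and symmetric binary relation. Then the relativization Rl_E(Re(U)) is a weakly associative relation algebra; concretely, writing X;Y := (X|Y)∩E, X⌣ := X⁻¹∩E, 1' := Id_U∩E, and ‾X := E∖X for X,Y ⊆ E, the following hold for all R,S,T ⊆ E: ((R∩1');E);E = (R∩1');E (weak associative law), (R∪S);T = (R;T)∪(S;T), R;1' = R, (R⌣)⌣ = R, (R∪S)⌣ = R⌣∪S⌣, (R;S)⌣ = S⌣;R⌣, and R⌣;(E∖(R;S)) ⊆ E∖S (Tarski/De Morgan axiom). -/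
/-- Relational composition of binary relations. -/
def relComp {U : Type*} (R S : Set (U × U)) : Set (U × U) :=
  {p | ∃ w, (p.1, w) ∈ R ∧ (w, p.2) ∈ S}

/-- Inverse of a binary relation. -/
def relInv {U : Type*} (R : Set (U × U)) : Set (U × U) :=
  {p | (p.2, p.1) ∈ R}

/-- The identity relation. -/
def idRel' {U : Type*} : Set (U × U) :=
  {p | p.1 = p.2}

/-- Relativized composition: `X ; Y := (X|Y) ∩ E`. -/
def rlComp {U : Type*} (E R S : Set (U × U)) : Set (U × U) := relComp R S ∩ E

/-- Relativized converse: `X⌣ := X⁻¹ ∩ E`. -/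
def rlInv {U : Type*} (E R : Set (U × U)) : Set (U × U) := relInv R ∩ E

/-- If `E ⊆ U×U` is reflexive and symmetric, then the relativization
`Rl_E(Re(U))` is a weakly associative relation algebra. -/
theorem stmt_0 {U : Type*} (E : Set (U × U))
    (hsymm : ∀ u v : U, (u, v) ∈ E → (v, u) ∈ E)
    (hrefl : ∀ u v : U, (u, v) ∈ E → (u, u) ∈ E ∧ (v, v) ∈ E)
    (R S T : Set (U × U)) (hR : R ⊆ E) (hS : S ⊆ E) (hT : T ⊆ E) :
    rlComp E (rlComp E (R ∩ (idRel' ∩ E)) E) E = rlComp E (R ∩ (idRel' ∩ E)) E ∧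
    rlComp E (R ∪ S) T = rlComp E R T ∪ rlComp E S T ∧
    rlComp E R (idRel' ∩ E) = R ∧
    rlInv E (rlInv E R) = R ∧
    rlInv E (R ∪ S) = rlInv E R ∪ rlInv E S ∧
    rlInv E (rlComp E R S) = rlComp E (rlInv E S) (rlInv E R) ∧
    rlComp E (rlInv E R) (E \ rlComp E R S) ⊆ E \ S := by
  refine ⟨?_, ?_, ?_, ?_, ?_, ?_, ?_⟩
  · ext ⟨x, y⟩
    constructor
    · rintro ⟨⟨w, ⟨⟨v, ⟨hv, hid, hvE⟩, -⟩, -⟩, -⟩, hxy⟩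
      obtain rfl : x = v := hid
      exact ⟨⟨x, ⟨hv, rfl, hvE⟩, hxy⟩, hxy⟩
    · rintro ⟨⟨v, ⟨hv, hid, hvE⟩, -⟩, hxy⟩
      obtain rfl : x = v := hid
      exact ⟨⟨x, ⟨⟨x, ⟨hv, rfl, hvE⟩, hvE⟩, hvE⟩, hxy⟩, hxy⟩
  · ext ⟨x, y⟩
    constructor
    · rintro ⟨⟨w, hR' | hS', hw⟩, hxy⟩
      · exact Or.inl ⟨⟨w, hR', hw⟩, hxy⟩
      · exact Or.inr ⟨⟨w, hS', hw⟩, hxy⟩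
    · rintro (⟨⟨w, h, hw⟩, hxy⟩ | ⟨⟨w, h, hw⟩, hxy⟩)
      · exact ⟨⟨w, Or.inl h, hw⟩, hxy⟩
      · exact ⟨⟨w, Or.inr h, hw⟩, hxy⟩
  · ext ⟨x, y⟩
    constructor
    · rintro ⟨⟨w, h, hid, -⟩, -⟩
      obtain rfl : w = y := hid
      exact h
    · intro h
      exact ⟨⟨y, h, rfl, (hrefl x y (hR h)).2⟩, hR h⟩
  · ext ⟨x, y⟩
    constructor
    · rintro ⟨⟨h, -⟩, -⟩
      exact h
    · intro h
      exact ⟨⟨h, hsymm x y (hR h)⟩, hR h⟩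
  · exact Set.union_inter_distrib_right _ _ _
  · ext ⟨x, y⟩
    constructor
    · rintro ⟨⟨⟨w, hyw, hwx⟩, -⟩, hxy⟩
      exact ⟨⟨w, ⟨hwx, hsymm w x (hS hwx)⟩, ⟨hyw, hsymm y w (hR hyw)⟩⟩, hxy⟩
    · rintro ⟨⟨w, ⟨hwx, -⟩, ⟨hyw, -⟩⟩, hxy⟩
      exact ⟨⟨⟨w, hyw, hwx⟩, hsymm x y hxy⟩, hxy⟩
  · rintro ⟨x, y⟩ ⟨⟨w, ⟨hwx, -⟩, hwy, hn⟩, hxy⟩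
    exact ⟨hxy, fun h => hn ⟨⟨x, hwx, h⟩, hwy⟩⟩
end

section
/- Let A be a weakly associative relation algebra. Then there exist a set U and a symmetric and reflexive binary relation E ⊆ U×U such that A is isomorphic to a subalgebra of the relativization Rl_E(Re(U)); that is, there is an injective map F : A → {R : R ⊆ E} satisfying F(x+y) = F(x)∪F(y), F(‾x) = E∖F(x), F(x;y) = (F(x)|F(y))∩E, F(x⌣) = F(x)⁻¹∩E, and F(1') = Id_U∩E for all x, y ∈ A. -/
universe u

/-- A weakly associative relation algebra: a Boolean algebra equipped with
relative multiplication `comp`, converse `conv`, and identity `one'`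
satisfying the WA axioms. -/
structure WA (A : Type*) [BooleanAlgebra A] where
  comp : A → A → A
  conv : A → A
  one' : A
  wassoc : ∀ x : A, comp (comp (x ⊓ one') ⊤) ⊤ = comp (x ⊓ one') ⊤
  rdist : ∀ x y z : A, comp (x ⊔ y) z = comp x z ⊔ comp y z
  comp_one' : ∀ x : A, comp x one' = x
  conv_conv : ∀ x : A, conv (conv x) = x
  conv_sup : ∀ x y : A, conv (x ⊔ y) = conv x ⊔ conv y
  conv_comp : ∀ x y : A, conv (comp x y) = comp (conv y) (conv x)
  tarski : ∀ x y : A, comp (conv x) (comp x y)ᶜ ≤ yᶜ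

/-- The ultrafilters of a Boolean algebra, presented as its prime filters. -/
@[ext]
structure BoolUltrafilter (A : Type*) [BooleanAlgebra A] where
  carrier : Set A
  sup_mem_iff : ∀ a b : A, a ⊔ b ∈ carrier ↔ a ∈ carrier ∨ b ∈ carrier
  compl_mem_iff : ∀ a : A, aᶜ ∈ carrier ↔ a ∉ carrier

namespace BoolUltrafilter

variable {A : Type*} [BooleanAlgebra A] (p : BoolUltrafilter A)

theorem mem_of_le {a b : A} (h : a ≤ b) (ha : a ∈ p.carrier) : b ∈ p.carrier := by
  rw [← sup_eq_right.mpr h, p.sup_mem_iff]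
  exact Or.inl ha

theorem top_mem : ⊤ ∈ p.carrier := by
  by_contra h
  exact h (p.mem_of_le le_top ((p.compl_mem_iff ⊤).mpr h))

theorem bot_notMem : ⊥ ∉ p.carrier := by
  rw [← p.compl_mem_iff, compl_bot]
  exact p.top_mem

theorem inf_mem {a b : A} (ha : a ∈ p.carrier) (hb : b ∈ p.carrier) : a ⊓ b ∈ p.carrier := by
  by_contra h
  rw [← p.compl_mem_iff, compl_inf, p.sup_mem_iff, p.compl_mem_iff, p.compl_mem_iff] at h
  tauto

theorem eq_of_subset {p q : BoolUltrafilter A} (h : p.carrier ⊆ q.carrier) : p = q := by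
  ext a
  refine ⟨fun ha => h ha, fun ha => ?_⟩
  by_contra hp
  exact (q.compl_mem_iff a).mp (h ((p.compl_mem_iff a).mpr hp)) ha

/-- An element outside an ideal `S` lies in an ultrafilter disjoint from `S`. -/
theorem exists_mem_disjoint {S : Set A} (hbot : ⊥ ∈ S) (hle : ∀ x y : A, x ≤ y → y ∈ S → x ∈ S)
    (hsup : ∀ x y : A, x ∈ S → y ∈ S → x ⊔ y ∈ S) {a : A} (ha : a ∉ S) :
    ∃ p : BoolUltrafilter A, a ∈ p.carrier ∧ ∀ x ∈ p.carrier, x ∉ S := by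
  have hS : Order.IsIdeal S :=
    ⟨fun x y h hx => hle y x h hx, ⟨⊥, hbot⟩,
      fun x hx y hy => ⟨x ⊔ y, hsup x y hx hy, le_sup_left, le_sup_right⟩⟩
  have hdis : Disjoint (Order.PFilter.principal a : Set A) (hS.toIdeal : Set A) := by
    rw [Set.disjoint_left]
    exact fun x hx hxS => ha (hle a x hx hxS)
  obtain ⟨J, hJ, hSJ, hFJ⟩ := DistribLattice.prime_ideal_of_disjoint_filter_ideal hdis
  refine ⟨⟨(J : Set A)ᶜ, fun x y => ?_, fun x => ?_⟩, ?_, fun x hx hxS => hx (hSJ hxS)⟩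
  · simp only [Set.mem_compl_iff, SetLike.mem_coe, Order.Ideal.sup_mem_iff]
    tauto
  · simp only [Set.mem_compl_iff, SetLike.mem_coe, not_not]
    refine ⟨fun h => (hJ.mem_or_compl_mem).resolve_right h, fun hx hxc => ?_⟩
    exact hJ.toIsProper.top_notMem (sup_compl_eq_top (x := x) ▸ J.sup_mem hx hxc)
  · exact Set.disjoint_left.mp hFJ (Order.PFilter.mem_principal.mpr le_rfl)

theorem exists_mem_notMem {a b : A} (h : ¬a ≤ b) :
    ∃ p : BoolUltrafilter A, a ∈ p.carrier ∧ b ∉ p.carrier := by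
  obtain ⟨p, ha, hp⟩ := exists_mem_disjoint (S := Set.Iic b) bot_le
    (fun x y hxy hy => hxy.trans hy) (fun x y => sup_le) h
  exact ⟨p, ha, fun hb => hp b hb le_rfl⟩

end BoolUltrafilter

namespace WA

variable {A : Type*} [BooleanAlgebra A] (W : WA A)

theorem conv_mono {x y : A} (h : x ≤ y) : W.conv x ≤ W.conv y := by
  rw [← sup_eq_right.mpr h, W.conv_sup]
  exact le_sup_left

/-- Converse as an order automorphism. -/
def convIso : A ≃o A where
  toFun := W.conv
  invFun := W.conv
  left_inv := W.conv_conv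
  right_inv := W.conv_conv
  map_rel_iff' := fun {a b} =>
    ⟨fun h => by simpa only [Equiv.coe_fn_mk, W.conv_conv] using W.conv_mono h, W.conv_mono⟩

theorem conv_compl (x : A) : W.conv xᶜ = (W.conv x)ᶜ :=
  map_compl' W.convIso x

theorem conv_bot : W.conv ⊥ = ⊥ :=
  W.convIso.map_bot

theorem ldist (x y z : A) : W.comp x (y ⊔ z) = W.comp x y ⊔ W.comp x z := by
  rw [← W.conv_conv (W.comp x (y ⊔ z)), W.conv_comp, W.conv_sup, W.rdist, W.conv_sup,
    ← W.conv_comp, ← W.conv_comp, W.conv_conv, W.conv_conv]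

theorem comp_mono {x x' y y' : A} (hx : x ≤ x') (hy : y ≤ y') : W.comp x y ≤ W.comp x' y' := by
  rw [← sup_eq_right.mpr hx, ← sup_eq_right.mpr hy, W.rdist, W.ldist]
  exact le_sup_left.trans le_sup_left

theorem comp_le_compl {x y z : A} (h : W.comp x y ≤ zᶜ) : W.comp (W.conv x) z ≤ yᶜ :=
  (W.comp_mono le_rfl (le_compl_comm.mp h)).trans (W.tarski x y)

theorem comp_bot (x : A) : W.comp x ⊥ = ⊥ := by
  have h : W.comp (W.conv x) ⊤ ≤ ⊥ᶜ := by simp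
  simpa [W.conv_conv] using W.comp_le_compl h

theorem bot_comp (x : A) : W.comp ⊥ x = ⊥ := by
  rw [← W.conv_conv (W.comp ⊥ x), W.conv_comp, W.conv_bot, W.comp_bot, W.conv_bot]

end WA

/-- The properties of the ultrafilter frame of a weakly associative relation algebra: a ternary
composition relation `T`, a converse, and a set `I` of identity points. -/
structure WAFrame (P : Type*) where
  T : P → P → P → Prop
  conv : P → P
  I : Set P
  conv_conv : ∀ p, conv (conv p) = p
  conv_left : ∀ {p q r}, T p q r → T (conv p) r q
  conv_triple : ∀ {p q r}, T p q r → T (conv q) (conv p) (conv r)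
  exists_right_unit : ∀ p, ∃ e ∈ I, T p e p
  eq_of_right_unit : ∀ {p e q}, e ∈ I → T p e q → p = q
  exists_left_unit_comp : ∀ {e p r q s}, e ∈ I → T e p r → T r q s → ∃ t, T e t s

namespace WA

variable {A : Type*} [BooleanAlgebra A] (W : WA A)

/-- The composition relation on ultrafilters. -/
def UComp (p q r : BoolUltrafilter A) : Prop :=
  ∀ a ∈ p.carrier, ∀ b ∈ q.carrier, W.comp a b ∈ r.carrier

/-- The converse of an ultrafilter. -/
def uconv (p : BoolUltrafilter A) : BoolUltrafilter A where
  carrier := {a | W.conv a ∈ p.carrier}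
  sup_mem_iff := fun a b => by simp only [Set.mem_ofPred_eq, W.conv_sup, p.sup_mem_iff]
  compl_mem_iff := fun a => by simp only [Set.mem_ofPred_eq, W.conv_compl, p.compl_mem_iff]

theorem exists_ucomp_of_left {p r : BoolUltrafilter A} {b : A}
    (h : ∀ a ∈ p.carrier, W.comp a b ∈ r.carrier) :
    ∃ q, b ∈ q.carrier ∧ W.UComp p q r := by
  obtain ⟨q, hb, hq⟩ := BoolUltrafilter.exists_mem_disjoint
    (S := {y | ∃ a ∈ p.carrier, W.comp a y ∉ r.carrier}) (a := b)
    ⟨⊤, p.top_mem, by rw [W.comp_bot]; exact r.bot_notMem⟩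
    (fun x y hxy ⟨a, ha, hy⟩ => ⟨a, ha, fun hx => hy (r.mem_of_le (W.comp_mono le_rfl hxy) hx)⟩)
    (fun x y ⟨a, ha, hx⟩ ⟨a', ha', hy⟩ => ⟨a ⊓ a', p.inf_mem ha ha', by
      rw [W.ldist, r.sup_mem_iff]
      rintro (h | h)
      · exact hx (r.mem_of_le (W.comp_mono inf_le_left le_rfl) h)
      · exact hy (r.mem_of_le (W.comp_mono inf_le_right le_rfl) h)⟩)
    (fun ⟨a, ha, hab⟩ => hab (h a ha))
  exact ⟨q, hb, fun a ha c hc => by_contra fun hac => hq c hc ⟨a, ha, hac⟩⟩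

theorem exists_ucomp {r : BoolUltrafilter A} {a b : A} (h : W.comp a b ∈ r.carrier) :
    ∃ p q, a ∈ p.carrier ∧ b ∈ q.carrier ∧ W.UComp p q r := by
  obtain ⟨p, ha, hp⟩ := BoolUltrafilter.exists_mem_disjoint
    (S := {x | W.comp x b ∉ r.carrier}) (a := a)
    (by rw [Set.mem_ofPred_eq, W.bot_comp]; exact r.bot_notMem)
    (fun x y hxy hy hx => hy (r.mem_of_le (W.comp_mono hxy le_rfl) hx))
    (fun x y hx hy => by
      rw [Set.mem_ofPred_eq, W.rdist, r.sup_mem_iff]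
      exact fun h => h.elim hx hy)
    (fun hab => hab h)
  obtain ⟨q, hb, hT⟩ := W.exists_ucomp_of_left (p := p) (r := r) (b := b)
    (fun x hx => by_contra fun hxb => hp x hx hxb)
  exact ⟨p, q, ha, hb, hT⟩

/-- The ultrafilter frame of a weakly associative relation algebra. -/
def frame : WAFrame (BoolUltrafilter A) where
  T := W.UComp
  conv := W.uconv
  I := {p | W.one' ∈ p.carrier}
  conv_conv := fun p => by
    ext a
    simp only [uconv, Set.mem_ofPred_eq, W.conv_conv]
  conv_left := fun {p q r} h a ha c hc => by
    by_contra hac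
    have hbad := h _ ha _ ((q.compl_mem_iff _).mpr hac)
    exact (r.compl_mem_iff c).mp (r.mem_of_le (W.tarski a c) hbad) hc
  conv_triple := fun {p q r} h a ha b hb => by
    have hba := h _ hb _ ha
    rwa [← W.conv_comp] at hba
  exists_right_unit := fun p =>
    W.exists_ucomp_of_left fun a ha => by rwa [W.comp_one']
  eq_of_right_unit := fun {p e q} he h =>
    BoolUltrafilter.eq_of_subset fun a ha => by
      simpa only [W.comp_one'] using h a ha _ he
  exists_left_unit_comp := fun {e p r q s} he hT hT' => by
    obtain ⟨t, -, ht⟩ := W.exists_ucomp_of_left (p := e) (r := s) (b := ⊤) fun x hx => by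
      have hr := hT _ (e.inf_mem hx he) _ p.top_mem
      have hs := hT' _ hr _ q.top_mem
      rw [W.wassoc] at hs
      exact s.mem_of_le (W.comp_mono inf_le_left le_rfl) hs
    exact ⟨t, ht⟩

end WA

namespace WAFrame

variable {P : Type*} (S : WAFrame P)

theorem conv_of_mem {e : P} (he : e ∈ S.I) : S.conv e = e := by
  obtain ⟨f, hf, h⟩ := S.exists_right_unit e
  have hef : S.conv e = f := S.eq_of_right_unit he (S.conv_left h)
  have h' := S.conv_triple h
  rw [← hef, S.conv_conv] at h'
  exact (S.eq_of_right_unit (hef ▸ hf) h').symm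

theorem conv_mem_iff {p : P} : S.conv p ∈ S.I ↔ p ∈ S.I := by
  refine ⟨fun h => ?_, fun h => by rwa [S.conv_of_mem h]⟩
  have h' := S.conv_of_mem h
  rw [S.conv_conv] at h'
  rwa [h']

theorem eq_of_left_unit {e p q : P} (he : e ∈ S.I) (h : S.T e p q) : p = q := by
  have h' := S.eq_of_right_unit (S.conv_mem_iff.mpr he) (S.conv_triple h)
  rw [← S.conv_conv p, h', S.conv_conv]

theorem left_unit_of_comp {e p q r : P} (he : e ∈ S.I) (hp : S.T e p p) (h : S.T p q r) :
    S.T e r r := by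
  obtain ⟨t, ht⟩ := S.exists_left_unit_comp he hp h
  rwa [S.eq_of_left_unit he ht] at ht

theorem comp_conv {p e : P} (h : S.T e p p) : S.T p (S.conv p) (S.conv e) := by
  simpa only [S.conv_conv] using S.conv_left (S.conv_triple h)

theorem left_unit_unique {e f p : P} (he : e ∈ S.I) (hf : f ∈ S.I)
    (h : S.T e p p) (h' : S.T f p p) : e = f := by
  have hff := S.comp_conv h'
  rw [S.conv_of_mem hf] at hff
  exact S.eq_of_right_unit hf (S.left_unit_of_comp he h hff)

theorem exists_left_unit (p : P) : ∃ e ∈ S.I, S.T e p p := by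
  obtain ⟨e, he, h⟩ := S.exists_right_unit (S.conv p)
  refine ⟨e, he, ?_⟩
  simpa only [S.conv_conv, S.conv_of_mem he] using S.conv_triple h

/-- The left unit of a point. -/
noncomputable def dom (p : P) : P := (S.exists_left_unit p).choose

theorem dom_mem (p : P) : S.dom p ∈ S.I := (S.exists_left_unit p).choose_spec.1

theorem dom_comp (p : P) : S.T (S.dom p) p p := (S.exists_left_unit p).choose_spec.2

/-- The right unit of a point. -/
noncomputable def rng (p : P) : P := S.dom (S.conv p)

theorem rng_conv (p : P) : S.rng (S.conv p) = S.dom p := by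
  rw [rng, S.conv_conv]

theorem rng_mem (p : P) : S.rng p ∈ S.I := S.dom_mem _

theorem comp_rng (p : P) : S.T p (S.rng p) p := by
  have h := S.conv_triple (S.dom_comp (S.conv p))
  rwa [S.conv_conv, S.conv_of_mem (S.dom_mem _)] at h

theorem dom_eq {p q r : P} (h : S.T p q r) : S.dom r = S.dom p :=
  S.left_unit_unique (S.dom_mem r) (S.dom_mem p) (S.dom_comp r)
    (S.left_unit_of_comp (S.dom_mem p) (S.dom_comp p) h)

theorem rng_eq_dom {p q r : P} (h : S.T p q r) : S.rng p = S.dom q :=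
  (S.dom_eq (S.conv_left h)).symm

theorem rng_eq {p q r : P} (h : S.T p q r) : S.rng r = S.rng q :=
  S.dom_eq (S.conv_triple h)

theorem dom_of_mem {e : P} (he : e ∈ S.I) : S.dom e = e :=
  S.eq_of_right_unit he (S.dom_comp e)

theorem rng_of_mem {e : P} (he : e ∈ S.I) : S.rng e = e := by
  rw [rng, S.conv_of_mem he, S.dom_of_mem he]

end WAFrame

/-- Names for the vertices of the representing graph: a base vertex for each identity point, and a
vertex `step u w p q` placed between `u` and `w` to witness that the label of `(u, w)` lies below
the composition of `p` and `q`. -/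
inductive Vertex (P : Type*) where
  | base (e : P)
  | step (u w : Vertex P) (p q : P)

namespace WAFrame

variable {P : Type*} (S : WAFrame P)

/-- `S.Label u v p` says that `(u, v)` is an edge of the representing graph with label `p`. -/
inductive Label : Vertex P → Vertex P → P → Prop
  | base {e : P} : e ∈ S.I → Label (.base e) (.base e) e
  | loop {u w : Vertex P} {p q r : P} : Label u w r → S.T p q r → p ∉ S.I → q ∉ S.I →
      Label (.step u w p q) (.step u w p q) (S.rng p)
  | left {u w : Vertex P} {p q r : P} : Label u w r → S.T p q r → p ∉ S.I → q ∉ S.I →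
      Label u (.step u w p q) p
  | left_conv {u w : Vertex P} {p q r : P} : Label u w r → S.T p q r → p ∉ S.I → q ∉ S.I →
      Label (.step u w p q) u (S.conv p)
  | right {u w : Vertex P} {p q r : P} : Label u w r → S.T p q r → p ∉ S.I → q ∉ S.I →
      Label (.step u w p q) w q
  | right_conv {u w : Vertex P} {p q r : P} : Label u w r → S.T p q r → p ∉ S.I → q ∉ S.I →
      Label w (.step u w p q) (S.conv q)

/-- The label of the loop at a vertex. -/
noncomputable def unit : Vertex P → P
  | .base e => e
  | .step _ _ p _ => S.rng p

variable {S}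

namespace Label

theorem symm {u v : Vertex P} {p : P} (h : S.Label u v p) : S.Label v u (S.conv p) := by
  cases h with
  | base he => rw [S.conv_of_mem he]; exact .base he
  | loop h hT hp hq => rw [S.conv_of_mem (S.rng_mem _)]; exact .loop h hT hp hq
  | left h hT hp hq => exact .left_conv h hT hp hq
  | left_conv h hT hp hq => rw [S.conv_conv]; exact .left h hT hp hq
  | right h hT hp hq => exact .right_conv h hT hp hq
  | right_conv h hT hp hq => rw [S.conv_conv]; exact .right h hT hp hq

theorem loops {u v : Vertex P} {p : P} (h : S.Label u v p) :
    S.Label u u (S.unit u) ∧ S.Label v v (S.unit v) := by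
  induction h with
  | base he => exact ⟨.base he, .base he⟩
  | loop h hT hp hq _ => exact ⟨.loop h hT hp hq, .loop h hT hp hq⟩
  | left h hT hp hq ih => exact ⟨ih.1, .loop h hT hp hq⟩
  | left_conv h hT hp hq ih => exact ⟨.loop h hT hp hq, ih.1⟩
  | right h hT hp hq ih => exact ⟨.loop h hT hp hq, ih.2⟩
  | right_conv h hT hp hq ih => exact ⟨ih.2, .loop h hT hp hq⟩

theorem unit_eq {u v : Vertex P} {p : P} (h : S.Label u v p) :
    S.unit u = S.dom p ∧ S.unit v = S.rng p := by
  induction h with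
  | base he => exact ⟨(S.dom_of_mem he).symm, (S.rng_of_mem he).symm⟩
  | @loop _ _ p _ _ _ _ _ _ _ =>
    exact ⟨(S.dom_of_mem (S.rng_mem p)).symm, (S.rng_of_mem (S.rng_mem p)).symm⟩
  | left _ hT _ _ ih => exact ⟨ih.1.trans (S.dom_eq hT), rfl⟩
  | left_conv _ hT _ _ ih => exact ⟨rfl, by rw [S.rng_conv, ih.1, S.dom_eq hT]⟩
  | right _ hT _ _ ih => exact ⟨S.rng_eq_dom hT, ih.2.trans (S.rng_eq hT)⟩
  | right_conv _ hT _ _ ih =>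
    exact ⟨ih.2.trans (S.rng_eq hT), by rw [S.rng_conv]; exact S.rng_eq_dom hT⟩

theorem mem_iff {u v : Vertex P} {p : P} (h : S.Label u v p) : p ∈ S.I ↔ u = v := by
  cases h with
  | base he => exact ⟨fun _ => rfl, fun _ => he⟩
  | loop => exact ⟨fun _ => rfl, fun _ => S.rng_mem _⟩
  | left _ _ hp _ =>
    refine ⟨fun h => (hp h).elim, fun h => ?_⟩
    have := congrArg sizeOf h
    simp only [Vertex.step.sizeOf_spec] at this
    omega
  | left_conv _ _ hp _ =>
    refine ⟨fun h => (hp (S.conv_mem_iff.mp h)).elim, fun h => ?_⟩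
    have := congrArg sizeOf h
    simp only [Vertex.step.sizeOf_spec] at this
    omega
  | right _ _ _ hq =>
    refine ⟨fun h => (hq h).elim, fun h => ?_⟩
    have := congrArg sizeOf h
    simp only [Vertex.step.sizeOf_spec] at this
    omega
  | right_conv _ _ _ hq =>
    refine ⟨fun h => (hq (S.conv_mem_iff.mp h)).elim, fun h => ?_⟩
    have := congrArg sizeOf h
    simp only [Vertex.step.sizeOf_spec] at this
    omega

theorem eq_unit {u : Vertex P} {p : P} (h : S.Label u u p) : p = S.unit u := by
  rw [h.unit_eq.1, S.dom_of_mem (h.mem_iff.mpr rfl)]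

theorem eq_or_exists_step {x y : Vertex P} {s : P} (h : S.Label x y s)
    (hle : sizeOf x ≤ sizeOf y) :
    x = y ∨ ∃ u w p q r, y = .step u w p q ∧ S.Label u w r ∧ S.T p q r := by
  cases h with
  | base => exact .inl rfl
  | loop => exact .inl rfl
  | left h hT _ _ => exact .inr ⟨_, _, _, _, _, rfl, h, hT⟩
  | right_conv h hT _ _ => exact .inr ⟨_, _, _, _, _, rfl, h, hT⟩
  | left_conv => simp only [Vertex.step.sizeOf_spec] at hle; omega
  | right => simp only [Vertex.step.sizeOf_spec] at hle; omega

theorem step_cases {x u w : Vertex P} {p q s : P} (h : S.Label x (.step u w p q) s)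
    (hle : sizeOf x ≤ sizeOf (Vertex.step u w p q)) (hne : x ≠ .step u w p q) :
    x = u ∧ s = p ∨ x = w ∧ s = S.conv q := by
  generalize hy : Vertex.step u w p q = y at *
  cases h with
  | base => exact (hne rfl).elim
  | loop => exact (hne rfl).elim
  | left => cases hy; exact .inl ⟨rfl, rfl⟩
  | right_conv => cases hy; exact .inr ⟨rfl, rfl⟩
  | left_conv => simp only [Vertex.step.sizeOf_spec] at hle; omega
  | right => simp only [Vertex.step.sizeOf_spec] at hle; omega

theorem eq_of_sizeOf_le {x y : Vertex P} {s t : P} (hs : S.Label x y s) (ht : S.Label x y t)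
    (hle : sizeOf x ≤ sizeOf y) : s = t := by
  rcases eq_or_ne x y with rfl | hne
  · rw [hs.eq_unit, ht.eq_unit]
  obtain ⟨u, w, p, q, r, rfl, h, hT⟩ := (hs.eq_or_exists_step hle).resolve_left hne
  have hpq : u = w → p = S.conv q := fun huw => by
    rw [← S.eq_of_right_unit (h.mem_iff.mpr huw) (S.conv_left hT), S.conv_conv]
  rcases hs.step_cases hle hne with ⟨h₁, rfl⟩ | ⟨h₁, rfl⟩ <;>
    rcases ht.step_cases hle hne with ⟨h₂, rfl⟩ | ⟨h₂, rfl⟩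
  · rfl
  · exact hpq (h₁.symm.trans h₂)
  · exact (hpq (h₂.symm.trans h₁)).symm
  · rfl

theorem unique {x y : Vertex P} {s t : P} (hs : S.Label x y s) (ht : S.Label x y t) :
    s = t := by
  rcases le_total (sizeOf x) (sizeOf y) with hle | hle
  · exact hs.eq_of_sizeOf_le ht hle
  · rw [← S.conv_conv s, hs.symm.eq_of_sizeOf_le ht.symm hle, S.conv_conv]

theorem comp_of_eq {x y z : Vertex P} {a b c : P} (hxy : S.Label x y a) (hyz : S.Label y z b)
    (hxz : S.Label x z c) (heq : x = y ∨ y = z ∨ x = z) : S.T a b c := by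
  rcases heq with rfl | rfl | rfl
  · rw [hxy.eq_unit, hyz.unit_eq.1, hxz.unique hyz]
    exact S.dom_comp b
  · rw [hyz.eq_unit, hxy.unit_eq.2, hxz.unique hxy]
    exact S.comp_rng a
  · rw [hxz.eq_unit, hyz.unique hxy.symm, hxy.unit_eq.1]
    simpa only [S.conv_of_mem (S.dom_mem a)] using S.comp_conv (S.dom_comp a)

theorem comp_of_sizeOf_le {x y z : Vertex P} {a b c : P} (hxy : S.Label x y a)
    (hyz : S.Label y z b) (hxz : S.Label x z c) (hx : sizeOf x ≤ sizeOf y)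
    (hz : sizeOf z ≤ sizeOf y) : S.T a b c := by
  by_cases heq : x = y ∨ y = z ∨ x = z
  · exact comp_of_eq hxy hyz hxz heq
  push Not at heq
  obtain ⟨hne, hne', hne''⟩ := heq
  obtain ⟨u, w, p, q, r, rfl, h, hT⟩ := (hxy.eq_or_exists_step hx).resolve_left hne
  rcases hxy.step_cases hx hne with ⟨rfl, rfl⟩ | ⟨rfl, rfl⟩ <;>
    rcases hyz.symm.step_cases hz hne'.symm with ⟨rfl, hb⟩ | ⟨rfl, hb⟩
  · exact (hne'' rfl).elim
  · rw [← S.conv_conv b, hb, S.conv_conv, hxz.unique h]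
    exact hT
  · rw [← S.conv_conv b, hb, hxz.unique h.symm]
    exact S.conv_triple hT
  · exact (hne'' rfl).elim

/-- Every triangle of the representing graph is consistent. -/
theorem comp {x y z : Vertex P} {a b c : P} (hxy : S.Label x y a) (hyz : S.Label y z b)
    (hxz : S.Label x z c) : S.T a b c := by
  by_cases h₁ : sizeOf x ≤ sizeOf y ∧ sizeOf z ≤ sizeOf y
  · exact comp_of_sizeOf_le hxy hyz hxz h₁.1 h₁.2
  by_cases h₂ : sizeOf y ≤ sizeOf x ∧ sizeOf z ≤ sizeOf x
  · simpa only [S.conv_conv] using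
      S.conv_left (comp_of_sizeOf_le hxy.symm hxz hyz h₂.1 h₂.2)
  · have h := comp_of_sizeOf_le hxz hyz.symm hxy (by omega) (by omega)
    simpa only [S.conv_conv] using S.conv_triple (S.conv_left (S.conv_triple h))

/-- Every composition below the label of an edge is witnessed by a vertex. -/
theorem exists_witness {x z : Vertex P} {p q r : P} (h : S.Label x z r) (hT : S.T p q r) :
    ∃ y, S.Label x y p ∧ S.Label y z q := by
  by_cases hp : p ∈ S.I
  · have hpx : S.unit x = p := by rw [h.unit_eq.1, S.dom_eq hT, S.dom_of_mem hp]
    exact ⟨x, hpx ▸ h.loops.1, S.eq_of_left_unit hp hT ▸ h⟩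
  by_cases hq : q ∈ S.I
  · have hqz : S.unit z = q := by rw [h.unit_eq.2, S.rng_eq hT, S.rng_of_mem hq]
    exact ⟨z, S.eq_of_right_unit hq hT ▸ h, hqz ▸ h.loops.2⟩
  · exact ⟨.step x z p q, .left h hT hp hq, .right h hT hp hq⟩

end Label

theorem exists_label (S : WAFrame P) (p : P) : ∃ x y, S.Label x y p := by
  have hT := S.comp_conv (S.dom_comp p)
  rw [S.conv_of_mem (S.dom_mem p)] at hT
  obtain ⟨y, hy, -⟩ := (Label.base (S.dom_mem p)).exists_witness hT
  exact ⟨_, y, hy⟩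

end WAFrame

/-- Every weakly associative relation algebra is isomorphic to a subalgebra of
the relativization, to a symmetric-reflexive relation `E`, of the algebra of
all binary relations on a set `U`. -/
theorem stmt_1 {A : Type u} [BooleanAlgebra A] (W : WA A) :
    ∃ (U : Type u) (E : Set (U × U)),
      (∀ u v : U, (u, v) ∈ E → (v, u) ∈ E) ∧
      (∀ u v : U, (u, v) ∈ E → (u, u) ∈ E ∧ (v, v) ∈ E) ∧
      ∃ F : A → Set (U × U),
        Function.Injective F ∧
        (∀ x : A, F x ⊆ E) ∧
        (∀ x y : A, F (x ⊔ y) = F x ∪ F y) ∧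
        (∀ x : A, F xᶜ = E \ F x) ∧
        (∀ x y : A, F (W.comp x y) = relComp (F x) (F y) ∩ E) ∧
        (∀ x : A, F (W.conv x) = relInv (F x) ∩ E) ∧
        F W.one' = idRel' ∩ E := by
  let S := W.frame
  refine ⟨Vertex (BoolUltrafilter A), {e | ∃ p, S.Label e.1 e.2 p}, ?_, ?_,
    fun a => {e | ∃ p, S.Label e.1 e.2 p ∧ a ∈ p.carrier}, ?_, ?_, ?_, ?_, ?_, ?_, ?_⟩
  · rintro u v ⟨p, h⟩
    exact ⟨_, h.symm⟩
  · rintro u v ⟨p, h⟩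
    exact ⟨⟨_, h.loops.1⟩, ⟨_, h.loops.2⟩⟩
  · have le_of_subset (a b : A) (hab : {e : Vertex _ × Vertex _ |
        ∃ p, S.Label e.1 e.2 p ∧ a ∈ p.carrier} ⊆ {e | ∃ p, S.Label e.1 e.2 p ∧ b ∈ p.carrier}) :
        a ≤ b := by
      by_contra hle
      obtain ⟨p, ha, hb⟩ := BoolUltrafilter.exists_mem_notMem hle
      obtain ⟨x, y, h⟩ := S.exists_label p
      obtain ⟨q, hq, hbq⟩ := hab (a := (x, y)) ⟨p, h, ha⟩
      exact hb (h.unique hq ▸ hbq)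
    exact fun a b hab => le_antisymm (le_of_subset a b hab.subset) (le_of_subset b a hab.superset)
  · rintro a e ⟨p, h, -⟩
    exact ⟨p, h⟩
  · rintro a b
    ext e
    simp only [Set.mem_union, Set.mem_ofPred_eq, BoolUltrafilter.sup_mem_iff, and_or_left,
      exists_or]
  · rintro a
    ext e
    constructor
    · rintro ⟨p, h, ha⟩
      refine ⟨⟨p, h⟩, ?_⟩
      rintro ⟨q, hq, haq⟩
      rw [h.unique hq] at ha
      exact (q.compl_mem_iff a).mp ha haq
    · rintro ⟨⟨p, h⟩, ha⟩
      exact ⟨p, h, (p.compl_mem_iff a).mpr fun hap => ha ⟨p, h, hap⟩⟩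
  · rintro a b
    ext ⟨x, z⟩
    constructor
    · rintro ⟨r, h, hab⟩
      obtain ⟨p, q, ha, hb, hT⟩ := W.exists_ucomp hab
      obtain ⟨y, hxy, hyz⟩ := h.exists_witness hT
      exact ⟨⟨y, ⟨p, hxy, ha⟩, ⟨q, hyz, hb⟩⟩, ⟨r, h⟩⟩
    · rintro ⟨⟨y, ⟨p, hxy, ha⟩, ⟨q, hyz, hb⟩⟩, ⟨r, h⟩⟩
      exact ⟨r, h, hxy.comp hyz h a ha b hb⟩
  · rintro a
    ext ⟨x, y⟩
    constructor
    · rintro ⟨p, h, ha⟩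
      exact ⟨⟨_, h.symm, ha⟩, ⟨p, h⟩⟩
    · rintro ⟨⟨p, h, ha⟩, -⟩
      refine ⟨_, h.symm, ?_⟩
      change W.conv (W.conv a) ∈ p.carrier
      rwa [W.conv_conv]
  · ext ⟨x, y⟩
    constructor
    · rintro ⟨p, h, hp⟩
      exact ⟨h.mem_iff.mp hp, ⟨p, h⟩⟩
    · rintro ⟨hxy, ⟨p, h⟩⟩
      exact ⟨p, h, h.mem_iff.mpr hxy⟩
end
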